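/- Privacy of the released Gaussian-process-perturbed function: let 𝔥 be the RKHS of a positive definite kernel K on 𝔛, let 𝔉 ⊆ 𝔥 with sup_{f,g∈𝔉} ‖f − g‖_𝔥 ≤ Δ, let Ξ be a centred Gaussian process with covariance kernel K, and let σ ≥ (Δ/α)√(2log(1/(2β)) + 2α) with α > 0, β ∈ (0,1/2). Then for every finite set of points t₁,…,t_m ∈ 𝔛 with invertible Gram matrix and every Borel B ⊆ ℝ^m, and all f, g ∈ 𝔉: P((f(t₁)+σΞ(t₁),…,f(t_m)+σΞ(t_m)) ∈ B) ≤ e^α P((g(t₁)+σΞ(t₁),…,g(t_m)+σΞ(t_m)) ∈ B) + β. -/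

import Mathlib

open MeasureTheory Matrix
open scoped RealInnerProductSpace

section GaussianWeight

variable {m : ℕ}

/-- The function `v ↦ exp (-⟨P v, v⟩ / 2) / Z` on `ℝᵐ`; for `P = S⁻¹` and
`Z = √((2π)ᵐ det S)` it is the density of the centred Gaussian law with covariance `S`. -/
noncomputable def gaussianWeight (P : Matrix (Fin m) (Fin m) ℝ) (Z : ℝ) (v : Fin m → ℝ) :
    ENNReal :=
  ENNReal.ofReal (Real.exp (-((P *ᵥ v) ⬝ᵥ v) / 2) / Z)

lemma continuous_quadForm (P : Matrix (Fin m) (Fin m) ℝ) :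
    Continuous fun v : Fin m → ℝ => (P *ᵥ v) ⬝ᵥ v :=
  (continuous_const.matrix_mulVec continuous_id).dotProduct continuous_id

lemma measurable_gaussianWeight (P : Matrix (Fin m) (Fin m) ℝ) (Z : ℝ) :
    Measurable (gaussianWeight P Z) := by
  have h := (continuous_quadForm P).measurable
  unfold gaussianWeight
  fun_prop

lemma quadForm_sub {P : Matrix (Fin m) (Fin m) ℝ} (hP : Pᵀ = P) (w d : Fin m → ℝ) :
    (P *ᵥ (w - d)) ⬝ᵥ (w - d) =
      (P *ᵥ w) ⬝ᵥ w - 2 * ((P *ᵥ d) ⬝ᵥ w) + (P *ᵥ d) ⬝ᵥ d := by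
  have h : (P *ᵥ w) ⬝ᵥ d = (P *ᵥ d) ⬝ᵥ w := by
    rw [dotProduct_comm, dotProduct_mulVec, ← mulVec_transpose, hP]
  rw [mulVec_sub, sub_dotProduct, dotProduct_sub, dotProduct_sub, h]
  ring

lemma gaussianWeight_sub_le {P : Matrix (Fin m) (Fin m) ℝ} (hP : Pᵀ = P) {Z : ℝ} (hZ : 0 ≤ Z)
    {w d : Fin m → ℝ} {κ : ℝ} (h : (P *ᵥ d) ⬝ᵥ w - ((P *ᵥ d) ⬝ᵥ d) / 2 ≤ κ) :
    gaussianWeight P Z (w - d) ≤ ENNReal.ofReal (Real.exp κ) * gaussianWeight P Z w := by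
  unfold gaussianWeight
  rw [← ENNReal.ofReal_mul (Real.exp_pos _).le, ← mul_div_assoc, ← Real.exp_add, quadForm_sub hP]
  gcongr
  linarith

/-- The measure of a translated set under a density is controlled by a pointwise comparison
of the density with its translate. -/
lemma withDensity_preimage_add_le {p : (Fin m → ℝ) → ENNReal} (hp : Measurable p)
    {A : Set (Fin m → ℝ)} (hA : MeasurableSet A) (d : Fin m → ℝ) (c : ENNReal)
    (h : ∀ w ∈ A, p (w - d) ≤ c * p w) :
    (volume.withDensity p) ((fun v => v + d) ⁻¹' A) ≤ c * (volume.withDensity p) A := by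
  have hA' : MeasurableSet ((fun v : Fin m → ℝ => v + d) ⁻¹' A) := measurable_add_const d hA
  rw [withDensity_apply _ hA, withDensity_apply _ hA', ← lintegral_const_mul _ hp,
    ← lintegral_indicator hA', ← lintegral_indicator hA,
    ← lintegral_add_right_eq_self (fun w => A.indicator (fun a => c * p a) w) d]
  refine lintegral_mono fun v => ?_
  by_cases hv : v + d ∈ A
  · rw [Set.indicator_of_mem (show v ∈ (fun v => v + d) ⁻¹' A from hv), Set.indicator_of_mem hv]
    simpa using h _ hv
  · rw [Set.indicator_of_notMem (show v ∉ (fun v => v + d) ⁻¹' A from hv)]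
    exact zero_le

lemma lintegral_exp_neg_half_dotProduct_self :
    ∫⁻ w : Fin m → ℝ, ENNReal.ofReal (Real.exp (-(w ⬝ᵥ w) / 2)) =
      ENNReal.ofReal (Real.sqrt (2 * Real.pi) ^ m) := by
  have hexp : ∀ w : Fin m → ℝ, Real.exp (-(w ⬝ᵥ w) / 2) =
      ∏ i, Real.exp (-(1 / 2) * w i ^ 2) := fun w => by
    rw [← Real.exp_sum, dotProduct, ← Finset.mul_sum]
    congr 1
    simp only [pow_two]
    ring
  have hint : Integrable (fun x : ℝ => Real.exp (-(1 / 2) * x ^ 2)) :=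
    integrable_exp_neg_mul_sq (by norm_num)
  simp_rw [hexp]
  have hprod : Integrable (fun w : Fin m → ℝ => ∏ i, Real.exp (-(1 / 2) * w i ^ 2)) volume :=
    Integrable.fintype_prod (f := fun _ x => Real.exp (-(1 / 2) * x ^ 2)) fun _ => hint
  rw [← ofReal_integral_eq_lintegral_ofReal hprod
      (ae_of_all _ fun w => Finset.prod_nonneg fun i _ => (Real.exp_pos _).le),
    integral_fintype_prod_volume_eq_pow (fun x : ℝ => Real.exp (-(1 / 2) * x ^ 2)),
    integral_gaussian, Fintype.card_fin]
  congr 3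
  ring

open scoped MatrixOrder in
lemma lintegral_gaussianWeight_inv {S : Matrix (Fin m) (Fin m) ℝ} (hS : S.PosDef) :
    ∫⁻ v, gaussianWeight S⁻¹ (Real.sqrt ((2 * Real.pi) ^ m * S.det)) v = 1 := by
  obtain ⟨y, hy⟩ := CStarAlgebra.nonneg_iff_eq_star_mul_self.mp hS.inv.posSemidef.nonneg
  rw [star_eq_conjTranspose, conjTranspose_eq_transpose_of_trivial] at hy
  have hdetS : 0 < S.det := hS.det_pos
  have hdet : S.det⁻¹ = y.det ^ 2 := by
    rw [← Ring.inverse_eq_inv', ← det_nonsing_inv, hy, det_mul, det_transpose, pow_two]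
  have hy0 : y.det ≠ 0 := fun h => by
    rw [h] at hdet
    simp [hdetS.ne'] at hdet
  have hSdet : S.det = (y.det⁻¹) ^ 2 := by rw [inv_pow, ← hdet, inv_inv]
  have hquad : ∀ v : Fin m → ℝ, (S⁻¹ *ᵥ v) ⬝ᵥ v = toLin' y v ⬝ᵥ toLin' y v := fun v => by
    rw [hy, ← mulVec_mulVec, toLin'_apply, dotProduct_comm, dotProduct_mulVec, vecMul_transpose]
  set Z := Real.sqrt ((2 * Real.pi) ^ m * S.det) with hZ
  have hZeq : Z = Real.sqrt (2 * Real.pi) ^ m * |y.det⁻¹| := by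
    rw [hZ, Real.sqrt_mul (by positivity), hSdet, Real.sqrt_sq_eq_abs]
    congr 1
    rw [Real.sqrt_eq_iff_mul_self_eq (by positivity) (by positivity), ← mul_pow,
      Real.mul_self_sqrt (by positivity)]
  have hZpos : 0 < Z := by rw [hZ]; positivity
  have hmeas : Measurable fun w : Fin m → ℝ => ENNReal.ofReal (Real.exp (-(w ⬝ᵥ w) / 2)) := by
    have h : Continuous fun w : Fin m → ℝ => w ⬝ᵥ w := continuous_id.dotProduct continuous_id
    have := h.measurable
    fun_prop
  have hlin : Measurable (toLin' y) := (toLin' y).continuous_of_finiteDimensional.measurable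
  have hsplit : ∀ v, gaussianWeight S⁻¹ Z v = ENNReal.ofReal Z⁻¹ *
      ENNReal.ofReal (Real.exp (-(toLin' y v ⬝ᵥ toLin' y v) / 2)) := fun v => by
    rw [gaussianWeight, hquad, ← ENNReal.ofReal_mul (by positivity), div_eq_inv_mul]
  simp_rw [hsplit]
  have hcomp : Measurable fun v : Fin m → ℝ =>
      ENNReal.ofReal (Real.exp (-(toLin' y v ⬝ᵥ toLin' y v) / 2)) := hmeas.comp hlin
  rw [lintegral_const_mul _ hcomp,
    ← lintegral_map (f := fun w => ENNReal.ofReal (Real.exp (-(w ⬝ᵥ w) / 2))) hmeas hlin,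
    Real.map_matrix_volume_pi_eq_smul_volume_pi hy0, lintegral_smul_measure,
    lintegral_exp_neg_half_dotProduct_self, smul_eq_mul, ← ENNReal.ofReal_mul (abs_nonneg _),
    ← ENNReal.ofReal_mul (by positivity), mul_comm |y.det⁻¹|, ← hZeq,
    inv_mul_cancel₀ hZpos.ne', ENNReal.ofReal_one]

lemma measurableSet_lt_dotProduct (c : ℝ) (u : Fin m → ℝ) :
    MeasurableSet {w : Fin m → ℝ | c < u ⬝ᵥ w} :=
  measurableSet_lt measurable_const (continuous_const.dotProduct continuous_id).measurable

lemma gaussianWeight_neg (P : Matrix (Fin m) (Fin m) ℝ) (Z : ℝ) (v : Fin m → ℝ) :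
    gaussianWeight P Z (-v) = gaussianWeight P Z v := by
  simp [gaussianWeight, mulVec_neg]

/-- An open half-space bounded by a hyperplane through the origin has centred Gaussian
mass at most one half. -/
lemma withDensity_gaussianWeight_halfspace_le (P : Matrix (Fin m) (Fin m) ℝ) (Z : ℝ)
    (h1 : ∫⁻ v, gaussianWeight P Z v = 1) (u : Fin m → ℝ) :
    (volume.withDensity (gaussianWeight P Z)) {w | 0 < u ⬝ᵥ w} ≤ ENNReal.ofReal (1 / 2) := by
  have hpos := measurableSet_lt_dotProduct 0 u
  have hneg : MeasurableSet {w : Fin m → ℝ | 0 < (-u) ⬝ᵥ w} := measurableSet_lt_dotProduct 0 (-u)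
  set μ := volume.withDensity (gaussianWeight P Z) with hμ
  have hsymm : μ {w | 0 < (-u) ⬝ᵥ w} = μ {w | 0 < u ⬝ᵥ w} := by
    rw [hμ, withDensity_apply _ hpos, withDensity_apply _ hneg, ← lintegral_indicator hpos,
      ← lintegral_indicator hneg, ← lintegral_neg_eq_self]
    refine lintegral_congr fun v => ?_
    simp [Set.indicator_apply, gaussianWeight_neg]
  have hdisj : Disjoint {w : Fin m → ℝ | 0 < u ⬝ᵥ w} {w | 0 < (-u) ⬝ᵥ w} := by
    rw [Set.disjoint_left]
    intro w hw hw'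
    simp only [Set.mem_ofPred_eq, neg_dotProduct] at hw hw'
    linarith
  have htot : μ {w | 0 < u ⬝ᵥ w} + μ {w | 0 < u ⬝ᵥ w} ≤ 1 := by
    nth_rewrite 2 [← hsymm]
    rw [← measure_union hdisj hneg, ← h1, ← setLIntegral_univ, ← withDensity_apply _ .univ]
    exact measure_mono (Set.subset_univ _)
  rw [one_div, ENNReal.ofReal_inv_of_pos two_pos, ENNReal.ofReal_ofNat, ← one_div,
    ENNReal.le_div_iff_mul_le (by simp) (by simp), mul_two]
  exact htot

/-- Gaussian tail bound with the sharp constant one half, for a half-space at nonnegative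
distance from the origin. -/
lemma withDensity_gaussianWeight_tail_le {P : Matrix (Fin m) (Fin m) ℝ} (hP : Pᵀ = P) {Z : ℝ}
    (hZ : 0 ≤ Z) (h1 : ∫⁻ v, gaussianWeight P Z v = 1) {d : Fin m → ℝ}
    (hd : 0 < (P *ᵥ d) ⬝ᵥ d) {s : ℝ} (hs : 0 ≤ s) :
    (volume.withDensity (gaussianWeight P Z)) {v | s < (P *ᵥ d) ⬝ᵥ v} ≤
      ENNReal.ofReal (Real.exp (-(s ^ 2 / (2 * ((P *ᵥ d) ⬝ᵥ d))))) * ENNReal.ofReal (1 / 2) := by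
  set q := (P *ᵥ d) ⬝ᵥ d with hq
  have hset : {v | s < (P *ᵥ d) ⬝ᵥ v} =
      (fun v => v + -(s / q) • d) ⁻¹' {w | 0 < (P *ᵥ d) ⬝ᵥ w} := by
    ext v
    simp only [Set.mem_ofPred_eq, Set.mem_preimage, dotProduct_add, dotProduct_smul, ← hq,
      smul_eq_mul, neg_mul, div_mul_cancel₀ s hd.ne', ← sub_eq_add_neg, sub_pos]
  rw [hset]
  refine (withDensity_preimage_add_le (measurable_gaussianWeight P Z)
    (measurableSet_lt_dotProduct 0 _) _ _ fun w hw => gaussianWeight_sub_le hP hZ ?_).trans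
    (mul_le_mul_right (withDensity_gaussianWeight_halfspace_le P Z h1 _) _)
  have hw' : 0 < (P *ᵥ d) ⬝ᵥ w := hw
  simp only [mulVec_smul, smul_dotProduct, dotProduct_smul, smul_eq_mul, ← hq]
  have h2 : 0 ≤ s / q * ((P *ᵥ d) ⬝ᵥ w) := by positivity
  have h3 : -(s / q) * (-(s / q) * q) / 2 = s ^ 2 / (2 * q) := by field_simp
  rw [h3]
  linarith

/-- The Gaussian mechanism: translating a centred Gaussian law by `d` changes its values by at
most a factor `exp α` and an additive error `β`, provided `⟨P d, d⟩` is small enough. -/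
lemma withDensity_gaussianWeight_preimage_add_le {P : Matrix (Fin m) (Fin m) ℝ}
    (hPsd : P.PosSemidef)
    {Z : ℝ} (hZ : 0 ≤ Z) (h1 : ∫⁻ v, gaussianWeight P Z v = 1) {d : Fin m → ℝ} {α β : ℝ}
    (hα : 0 < α) (hβ : 0 < β) (hβ2 : β < 1 / 2)
    (hq : ((P *ᵥ d) ⬝ᵥ d) * (2 * Real.log (1 / (2 * β)) + 2 * α) ≤ α ^ 2)
    {A : Set (Fin m → ℝ)} (hA : MeasurableSet A) :
    (volume.withDensity (gaussianWeight P Z)) ((fun v => v + d) ⁻¹' A) ≤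
      ENNReal.ofReal (Real.exp α) * (volume.withDensity (gaussianWeight P Z)) A +
        ENNReal.ofReal β := by
  have hP : Pᵀ = P := by
    simpa [conjTranspose_eq_transpose_of_trivial] using hPsd.isHermitian.eq
  have hq0 : 0 ≤ (P *ᵥ d) ⬝ᵥ d := by
    simpa [dotProduct_comm] using hPsd.dotProduct_mulVec_nonneg d
  set μ := volume.withDensity (gaussianWeight P Z)
  set q := (P *ᵥ d) ⬝ᵥ d with hqdef
  have hL : 0 < Real.log (1 / (2 * β)) :=
    Real.log_pos (by rw [lt_div_iff₀ (by positivity)]; linarith)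
  have hqα : q ≤ α := by nlinarith
  set bad : Set (Fin m → ℝ) := {v | α - q / 2 < (P *ᵥ d) ⬝ᵥ v} with hbad
  set good : Set (Fin m → ℝ) := {w | α + q / 2 < (P *ᵥ d) ⬝ᵥ w}ᶜ with hgood
  have hgoodm : MeasurableSet good := (measurableSet_lt_dotProduct _ _).compl
  have hcover : (fun v => v + d) ⁻¹' A ⊆ (fun v => v + d) ⁻¹' (A ∩ good) ∪ bad := by
    intro v hv
    by_cases hb : v ∈ bad
    · exact Or.inr hb
    · refine Or.inl ⟨hv, ?_⟩
      simp only [hbad, hgood, Set.mem_ofPred_eq, Set.mem_compl_iff, not_lt, dotProduct_add,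
        ← hqdef] at hb ⊢
      linarith
  have hmain : μ ((fun v => v + d) ⁻¹' (A ∩ good)) ≤ ENNReal.ofReal (Real.exp α) * μ A := by
    refine (withDensity_preimage_add_le (measurable_gaussianWeight P Z) (hA.inter hgoodm) _ _
      fun w hw => gaussianWeight_sub_le hP hZ ?_).trans
      (mul_le_mul_right (measure_mono Set.inter_subset_left) _)
    have hw' := hw.2
    simp only [hgood, Set.mem_ofPred_eq, Set.mem_compl_iff, not_lt] at hw'
    linarith
  have htail : 0 < q → μ bad ≤ ENNReal.ofReal β := fun hqpos => by
    refine (withDensity_gaussianWeight_tail_le hP hZ h1 hqpos (by linarith)).trans ?_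
    rw [← ENNReal.ofReal_mul (Real.exp_pos _).le]
    refine ENNReal.ofReal_le_ofReal ?_
    have hexp : Real.exp (-((α - q / 2) ^ 2 / (2 * q))) ≤
        Real.exp (-Real.log (1 / (2 * β))) := by
      gcongr
      rw [le_div_iff₀ (by positivity)]
      nlinarith
    rw [Real.exp_neg (Real.log _), Real.exp_log (by positivity), one_div, inv_inv] at hexp
    linarith
  have hbadle : μ bad ≤ ENNReal.ofReal β := by
    rcases hq0.lt_or_eq with hqpos | hqzero
    · exact htail hqpos
    · have hPd : P *ᵥ d = 0 := by
        rw [← hPsd.dotProduct_mulVec_zero_iff, star_trivial, dotProduct_comm]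
        exact hqzero.symm
      have hempty : bad = ∅ := by
        ext v
        simp [hbad, ← hqzero, hPd, hα.le]
      simp [hempty]
  calc μ ((fun v => v + d) ⁻¹' A) ≤ μ ((fun v => v + d) ⁻¹' (A ∩ good)) + μ bad :=
        (measure_mono hcover).trans (measure_union_le _ _)
    _ ≤ _ := add_le_add hmain hbadle

end GaussianWeight

/-- In an inner product space, the `S⁻¹`-quadratic form of the vector of inner products of `h`
with finitely many vectors having invertible Gram matrix `S` is at most `‖h‖ ^ 2`. -/
lemma quadForm_inv_gram_le_norm_sq {ι H : Type*} [Fintype ι] [DecidableEq ι]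
    [NormedAddCommGroup H] [InnerProductSpace ℝ H] (x : ι → H) {S : Matrix ι ι ℝ}
    (hS : ∀ i j, S i j = ⟪x i, x j⟫) (hdet : IsUnit S.det) (h : H) :
    (S⁻¹ *ᵥ fun i => ⟪h, x i⟫) ⬝ᵥ (fun i => ⟪h, x i⟫) ≤ ‖h‖ ^ 2 := by
  set y : ι → ℝ := fun i => ⟪h, x i⟫ with hy
  set c := S⁻¹ *ᵥ y with hc
  have hSc : S *ᵥ c = y := by rw [hc, mulVec_mulVec, mul_nonsing_inv _ hdet, one_mulVec]
  have hhz : ⟪h, ∑ i, c i • x i⟫ = c ⬝ᵥ y := by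
    simp [inner_sum, inner_smul_right, dotProduct, hy]
  have hzz : ⟪∑ i, c i • x i, ∑ i, c i • x i⟫ = c ⬝ᵥ y := by
    rw [← hSc]
    simp only [inner_sum, sum_inner, inner_smul_right, real_inner_smul_left, dotProduct, mulVec,
      hS, Finset.mul_sum]
    rw [Finset.sum_comm]
    refine Finset.sum_congr rfl fun i _ => Finset.sum_congr rfl fun j _ => ?_
    ring
  have hnn := real_inner_self_nonneg (x := h - ∑ i, c i • x i)
  rw [real_inner_sub_sub_self, hhz, hzz, real_inner_self_eq_norm_sq] at hnn
  linarith

/-- Privacy of the Gaussian-process–perturbed functional release: if `f, g` lie in the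
RKHS with feature map `k` (kernel `K(t,s) = ⟪k t, k s⟫`, evaluation `f(t) = ⟪f, k t⟫`)
with `‖f - g‖ ≤ Δ`, and `σ ≥ (Δ/α)√(2 log(1/(2β)) + 2α)`, then for any finite set of
points with positive definite Gram matrix `S`, the finite-dimensional marginals (which
for the centred Gaussian process with covariance `K` are exactly `N(0, S)`) of the
released function satisfy the `(α,β)`-differential privacy inequality. -/
theorem gp_release_approx_dp {𝔛 H : Type*} [NormedAddCommGroup H]
    [InnerProductSpace ℝ H]
    (k : 𝔛 → H) (f g : H) (Δ α β σ : ℝ)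
    (hα : 0 < α) (hβ : 0 < β) (hβ2 : β < 1 / 2)
    (hfg : ‖f - g‖ ≤ Δ)
    (hσ : σ ≥ Δ / α * Real.sqrt (2 * Real.log (1 / (2 * β)) + 2 * α))
    {m : ℕ} (t : Fin m → 𝔛)
    (S : Matrix (Fin m) (Fin m) ℝ) (hS : ∀ i j, S i j = ⟪k (t i), k (t j)⟫)
    (hSpd : S.PosDef) :
    ∀ B : Set (Fin m → ℝ), MeasurableSet B →
      (Measure.map (fun v : Fin m → ℝ => fun i => ⟪f, k (t i)⟫ + σ * v i)
          (volume.withDensity fun v =>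
            ENNReal.ofReal (Real.exp (-((S⁻¹ *ᵥ v) ⬝ᵥ v) / 2) /
              Real.sqrt ((2 * Real.pi) ^ m * S.det)))) B
        ≤ ENNReal.ofReal (Real.exp α) *
            (Measure.map (fun v : Fin m → ℝ => fun i => ⟪g, k (t i)⟫ + σ * v i)
              (volume.withDensity fun v =>
                ENNReal.ofReal (Real.exp (-((S⁻¹ *ᵥ v) ⬝ᵥ v) / 2) /
                  Real.sqrt ((2 * Real.pi) ^ m * S.det)))) B
          + ENNReal.ofReal β := by
  intro B hB
  have hL : 0 < Real.log (1 / (2 * β)) :=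
    Real.log_pos (by rw [lt_div_iff₀ (by positivity)]; linarith)
  rcases eq_or_ne f g with rfl | hne
  · refine le_add_right (le_mul_of_one_le_left zero_le ?_)
    rw [ENNReal.one_le_ofReal]
    exact Real.one_le_exp hα.le
  have hnorm : 0 < ‖f - g‖ := norm_pos_iff.mpr (sub_ne_zero.mpr hne)
  have hΔ : 0 < Δ := hnorm.trans_le hfg
  have hσpos : 0 < σ := lt_of_lt_of_le (by positivity) hσ
  have hσ2 : Δ ^ 2 * (2 * Real.log (1 / (2 * β)) + 2 * α) ≤ α ^ 2 * σ ^ 2 := by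
    have h1 : Δ * Real.sqrt (2 * Real.log (1 / (2 * β)) + 2 * α) ≤ α * σ := by
      rw [ge_iff_le, div_mul_eq_mul_div, div_le_iff₀ hα] at hσ
      linarith
    have h2 := pow_le_pow_left₀ (by positivity) h1 2
    rwa [mul_pow, mul_pow, Real.sq_sqrt (by positivity)] at h2
  set y : Fin m → ℝ := fun i => ⟪f - g, k (t i)⟫ with hy
  have hyle : (S⁻¹ *ᵥ y) ⬝ᵥ y ≤ Δ ^ 2 :=
    (quadForm_inv_gram_le_norm_sq (fun i => k (t i)) hS hSpd.det_pos.ne'.isUnit (f - g)).trans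
      (pow_le_pow_left₀ hnorm.le hfg 2)
  have hq : (S⁻¹ *ᵥ (σ⁻¹ • y)) ⬝ᵥ (σ⁻¹ • y) = (S⁻¹ *ᵥ y) ⬝ᵥ y / σ ^ 2 := by
    rw [mulVec_smul, smul_dotProduct, dotProduct_smul, smul_eq_mul, smul_eq_mul]
    field_simp
  have hmeas : ∀ h : H, Measurable fun v : Fin m → ℝ => fun i => ⟪h, k (t i)⟫ + σ * v i :=
    fun h => by fun_prop
  rw [Measure.map_apply (hmeas f) hB, Measure.map_apply (hmeas g) hB]
  have hset : (fun v : Fin m → ℝ => fun i => ⟪f, k (t i)⟫ + σ * v i) ⁻¹' B =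
      (fun v => v + σ⁻¹ • y) ⁻¹'
        ((fun v : Fin m → ℝ => fun i => ⟪g, k (t i)⟫ + σ * v i) ⁻¹' B) := by
    rw [← Set.preimage_comp]
    congr 1
    funext v i
    simp only [Function.comp_apply, Pi.add_apply, Pi.smul_apply, smul_eq_mul, hy, inner_sub_left]
    field_simp
    ring
  rw [hset]
  refine withDensity_gaussianWeight_preimage_add_le hSpd.inv.posSemidef (Real.sqrt_nonneg _)
    (lintegral_gaussianWeight_inv hSpd) hα hβ hβ2 ?_ (hmeas g hB)
  rw [hq, div_mul_eq_mul_div, div_le_iff₀ (by positivity)]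
  exact (mul_le_mul_of_nonneg_right hyle (by positivity)).trans hσ2
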